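/- There exist δ₀ > 0 and C > 0, depending only on p, μ, v_±, s and the profile ṽ, such that for every T > 0, every δ ≤ δ₀, and every classical solution (Φ,Ψ) of the integrated perturbation system on ℝ × [0,T] satisfying the a priori smallness assumption with parameter δ, for all t ∈ [0,T]: ‖(Φ,Ψ)(t)‖₁² + ∫₀ᵗ ‖Φ_ξ(τ)‖₁² dτ ≤ C ‖(Φ₀,Ψ₀)‖₁². -/

import Mathlib

open MeasureTheory Filter Topology Set

noncomputable section

noncomputable def L2sq (w : ℝ → ℝ) : ℝ := ∫ ξ : ℝ, (w ξ) ^ 2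

noncomputable def HkSq (k : ℕ) (w : ℝ → ℝ) : ℝ :=
  ∑ j ∈ Finset.range (k + 1), L2sq (iteratedDeriv j w)

noncomputable def pairHkSq (k : ℕ) (F G : ℝ → ℝ) : ℝ := HkSq k F + HkSq k G

/-- The nonlinear remainder `G = (g'(v) - g'(ṽ))Φ_ξξ + (g'(v) - g'(ṽ) - g''(ṽ)Φ_ξ)ṽ_ξ`
with `v = ṽ + Φ_ξ`. -/
noncomputable def Gterm (g tv φ : ℝ → ℝ) (ξ : ℝ) : ℝ :=
  (deriv g (tv ξ + deriv φ ξ) - deriv g (tv ξ)) * iteratedDeriv 2 φ ξ +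
    (deriv g (tv ξ + deriv φ ξ) - deriv g (tv ξ)
      - deriv (deriv g) (tv ξ) * deriv φ ξ) * deriv tv ξ

/-- The relative pressure `p(v|ṽ) = p(v) - p(ṽ) - p'(ṽ)(v - ṽ)` with `v = ṽ + Φ_ξ`. -/
noncomputable def prel (p tv φ : ℝ → ℝ) (ξ : ℝ) : ℝ :=
  p (tv ξ + deriv φ ξ) - p (tv ξ) - deriv p (tv ξ) * deriv φ ξ

/-- A classical solution of the integrated perturbation system on `ℝ × [0,T]`:
`C⁴` in `ξ`, `C¹` in `t` with continuous mixed derivatives `∂_t ∂_ξ^j` (`j ≤ 3`),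
satisfying both equations pointwise, with square-integrable `ξ`-derivatives up to order 4
(`L²`-norms continuous in `t`) and derivatives up to order 3 decaying at spatial infinity,
uniformly in `t`. -/
structure IsClassicalSolution (p g tv : ℝ → ℝ) (s T : ℝ) (Φ Ψ : ℝ → ℝ → ℝ) : Prop where
  regΦ : ∀ t ∈ Set.Icc (0:ℝ) T, ContDiff ℝ 4 (Φ t)
  regΨ : ∀ t ∈ Set.Icc (0:ℝ) T, ContDiff ℝ 4 (Ψ t)
  tdiffΦ : ∀ j : ℕ, j ≤ 3 → ∀ t ∈ Set.Icc (0:ℝ) T, ∀ ξ : ℝ,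
    DifferentiableAt ℝ (fun τ => iteratedDeriv j (Φ τ) ξ) t
  tdiffΨ : ∀ j : ℕ, j ≤ 3 → ∀ t ∈ Set.Icc (0:ℝ) T, ∀ ξ : ℝ,
    DifferentiableAt ℝ (fun τ => iteratedDeriv j (Ψ τ) ξ) t
  mixContΦ : ∀ j : ℕ, j ≤ 3 → ContinuousOn
    (fun q : ℝ × ℝ => deriv (fun τ => iteratedDeriv j (Φ τ) q.2) q.1)
    (Set.Icc (0:ℝ) T ×ˢ (Set.univ : Set ℝ))
  mixContΨ : ∀ j : ℕ, j ≤ 3 → ContinuousOn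
    (fun q : ℝ × ℝ => deriv (fun τ => iteratedDeriv j (Ψ τ) q.2) q.1)
    (Set.Icc (0:ℝ) T ×ˢ (Set.univ : Set ℝ))
  spContΦ : ∀ j : ℕ, j ≤ 4 → ContinuousOn
    (fun q : ℝ × ℝ => iteratedDeriv j (Φ q.1) q.2)
    (Set.Icc (0:ℝ) T ×ˢ (Set.univ : Set ℝ))
  spContΨ : ∀ j : ℕ, j ≤ 4 → ContinuousOn
    (fun q : ℝ × ℝ => iteratedDeriv j (Ψ q.1) q.2)
    (Set.Icc (0:ℝ) T ×ˢ (Set.univ : Set ℝ))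
  eq1 : ∀ t ∈ Set.Icc (0:ℝ) T, ∀ ξ : ℝ,
    deriv (fun τ => Φ τ ξ) t - s * deriv (Φ t) ξ - deriv (Ψ t) ξ
        - deriv g (tv ξ) * iteratedDeriv 2 (Φ t) ξ
        - deriv (deriv g) (tv ξ) * deriv tv ξ * deriv (Φ t) ξ
      = Gterm g tv (Φ t) ξ
  eq2 : ∀ t ∈ Set.Icc (0:ℝ) T, ∀ ξ : ℝ,
    deriv (fun τ => Ψ τ ξ) t - s * deriv (Ψ t) ξ + deriv p (tv ξ) * deriv (Φ t) ξ
      = -prel p tv (Φ t) ξ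
  sqIntΦ : ∀ j : ℕ, j ≤ 4 → ∀ t ∈ Set.Icc (0:ℝ) T,
    MeasureTheory.Integrable (fun ξ : ℝ => (iteratedDeriv j (Φ t) ξ) ^ 2)
  sqIntΨ : ∀ j : ℕ, j ≤ 4 → ∀ t ∈ Set.Icc (0:ℝ) T,
    MeasureTheory.Integrable (fun ξ : ℝ => (iteratedDeriv j (Ψ t) ξ) ^ 2)
  l2ContΦ : ∀ j : ℕ, j ≤ 4 →
    ContinuousOn (fun t => L2sq (iteratedDeriv j (Φ t))) (Set.Icc (0:ℝ) T)
  l2ContΨ : ∀ j : ℕ, j ≤ 4 →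
    ContinuousOn (fun t => L2sq (iteratedDeriv j (Ψ t))) (Set.Icc (0:ℝ) T)
  decayΦ : ∀ j : ℕ, j ≤ 3 → ∀ ε > (0:ℝ), ∃ R : ℝ, ∀ t ∈ Set.Icc (0:ℝ) T, ∀ ξ : ℝ,
    R ≤ |ξ| → |iteratedDeriv j (Φ t) ξ| < ε
  decayΨ : ∀ j : ℕ, j ≤ 3 → ∀ ε > (0:ℝ), ∃ R : ℝ, ∀ t ∈ Set.Icc (0:ℝ) T, ∀ ξ : ℝ,
    R ≤ |ξ| → |iteratedDeriv j (Ψ t) ξ| < ε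

/-- One-dimensional Sobolev inequality `‖f‖_∞² ≤ ‖f‖² + ‖f'‖²`. -/
lemma sq_le_integral_sq_add_integral_deriv_sq {f f' : ℝ → ℝ}
    (hf : ∀ x, HasDerivAt f (f' x) x) (hf' : Continuous f')
    (hi : Integrable fun x => f x ^ 2) (hi' : Integrable fun x => f' x ^ 2)
    (hlim : Tendsto f atBot (𝓝 0)) (x : ℝ) :
    f x ^ 2 ≤ (∫ y, f y ^ 2) + ∫ y, f' y ^ 2 := by
  have hfc : Continuous f := continuous_iff_continuousAt.2 fun y => (hf y).continuousAt
  have hsum : Integrable fun y => f y ^ 2 + f' y ^ 2 := hi.add hi'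
  have key : ∀ y ≤ x, f x ^ 2 - f y ^ 2 ≤ (∫ y, f y ^ 2) + ∫ y, f' y ^ 2 := by
    intro y hy
    have h1 : (∫ z in y..x, 2 * f z * f' z) = f x ^ 2 - f y ^ 2 := by
      apply intervalIntegral.integral_eq_sub_of_hasDerivAt
      · intro z _
        simpa using (hf z).fun_pow 2
      · exact ((continuous_const.mul hfc).mul hf').intervalIntegrable _ _
    rw [← h1]
    calc (∫ z in y..x, 2 * f z * f' z) ≤ ∫ z in y..x, (f z ^ 2 + f' z ^ 2) := by
          apply intervalIntegral.integral_mono_on hy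
          · exact ((continuous_const.mul hfc).mul hf').intervalIntegrable _ _
          · exact hsum.intervalIntegrable
          · intro z _
            nlinarith [sq_nonneg (f z - f' z)]
      _ ≤ ∫ z, (f z ^ 2 + f' z ^ 2) := by
          rw [intervalIntegral.integral_of_le hy]
          exact setIntegral_le_integral hsum (ae_of_all _ fun z => by positivity)
      _ = _ := integral_add hi hi'
  have hl : Tendsto (fun y => f x ^ 2 - f y ^ 2) atBot (𝓝 (f x ^ 2)) := by
    simpa using (tendsto_const_nhds (x := f x ^ 2)).sub (hlim.pow 2)
  exact le_of_tendsto hl (eventually_atBot.2 ⟨x, key⟩)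

/-- Uniform first- and second-order Taylor bounds on a compact interval. -/
lemma exists_taylor_bound {f : ℝ → ℝ} (hf : ContDiffOn ℝ (⊤ : ℕ∞) f (Ioi 0)) {a b : ℝ}
    (ha : 0 < a) :
    ∃ L : ℝ, ∀ x ∈ Icc a b, ∀ y ∈ Icc a b,
      |f y - f x| ≤ L * |y - x| ∧ |f y - f x - deriv f x * (y - x)| ≤ L * (y - x) ^ 2 := by
  have hsub : Icc a b ⊆ Ioi (0 : ℝ) := fun x hx => ha.trans_le hx.1
  have hf1 : ContDiffOn ℝ (⊤ : ℕ∞) (deriv f) (Ioi 0) := hf.deriv_of_isOpen isOpen_Ioi (by simp)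
  have hf2 : ContDiffOn ℝ (⊤ : ℕ∞) (deriv (deriv f)) (Ioi 0) :=
    hf1.deriv_of_isOpen isOpen_Ioi (by simp)
  have hd : ∀ {h : ℝ → ℝ}, ContDiffOn ℝ (⊤ : ℕ∞) h (Ioi 0) → ∀ x ∈ Icc a b,
      HasDerivAt h (deriv h x) x := fun hh x hx =>
    ((hh.contDiffAt (isOpen_Ioi.mem_nhds (hsub hx))).differentiableAt (by simp)).hasDerivAt
  obtain ⟨L₁, hL₁⟩ := isCompact_Icc.exists_bound_of_continuousOn (hf1.continuousOn.mono hsub)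
  obtain ⟨L₂, hL₂⟩ := isCompact_Icc.exists_bound_of_continuousOn (hf2.continuousOn.mono hsub)
  refine ⟨max L₁ L₂, fun x hx y hy => ⟨?_, ?_⟩⟩
  · refine (Convex.norm_image_sub_le_of_norm_hasDerivWithin_le (f := f)
      (fun z hz => (hd hf z hz).hasDerivWithinAt) hL₁ (convex_Icc a b) hx hy).trans ?_
    exact mul_le_mul_of_nonneg_right (le_max_left _ _) (norm_nonneg _)
  · have hseg : uIcc x y ⊆ Icc a b := (convex_Icc a b).ordConnected.uIcc_subset hx hy
    have h := Convex.norm_image_sub_le_of_norm_hasDerivWithin_le (s := uIcc x y)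
      (f := fun z => f z - deriv f x * z) (f' := fun z => deriv f z - deriv f x)
      (C := max L₁ L₂ * |y - x|) (x := x) (y := y)
      (fun z hz => by
        have := (hd hf z (hseg hz)).fun_sub ((hasDerivAt_id' z).const_mul (deriv f x))
        simpa using this.hasDerivWithinAt)
      (fun z hz => by
        refine (Convex.norm_image_sub_le_of_norm_hasDerivWithin_le (f := deriv f)
          (fun z hz => (hd hf1 z hz).hasDerivWithinAt) hL₂ (convex_Icc a b) hx (hseg hz)).trans ?_
        have h0 : 0 ≤ L₂ := (norm_nonneg _).trans (hL₂ x hx)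
        exact mul_le_mul (le_max_right _ _) (abs_sub_left_of_mem_uIcc hz) (norm_nonneg _)
          (h0.trans (le_max_right _ _)))
      (convex_uIcc x y) left_mem_uIcc right_mem_uIcc
    rw [Real.norm_eq_abs, Real.norm_eq_abs, mul_assoc, ← abs_mul, ← sq, abs_sq] at h
    convert h using 2
    ring

/-- Commutation of mixed partial derivatives on a time strip. -/
lemma hasDerivAt_time_deriv {u ux ut uxt : ℝ → ℝ → ℝ} {T : ℝ}
    (hx : ∀ t ∈ Icc 0 T, ∀ ξ, HasDerivAt (u t) (ux t ξ) ξ)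
    (ht : ∀ t ∈ Icc 0 T, ∀ ξ, HasDerivAt (fun τ => u τ ξ) (ut t ξ) t)
    (hxt : ∀ t ∈ Icc 0 T, ∀ ξ, HasDerivAt (fun τ => ux τ ξ) (uxt t ξ) t)
    (hcx : ContinuousOn (fun q : ℝ × ℝ => ux q.1 q.2) (Icc 0 T ×ˢ univ))
    (hcxt : ContinuousOn (fun q : ℝ × ℝ => uxt q.1 q.2) (Icc 0 T ×ˢ univ))
    {t : ℝ} (htT : t ∈ Ioo 0 T) (ξ : ℝ) : HasDerivAt (ut t) (uxt t ξ) ξ := by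
  have hsl : ∀ {h : ℝ → ℝ → ℝ}, ContinuousOn (fun q : ℝ × ℝ => h q.1 q.2) (Icc 0 T ×ˢ univ) →
      ∀ τ ∈ Icc 0 T, Continuous (h τ) := fun hh τ hτ =>
    hh.comp_continuous (f := fun z => (τ, z)) (by fun_prop) fun z => ⟨hτ, mem_univ _⟩
  have htI : t ∈ Icc 0 T := Ioo_subset_Icc_self htT
  have key : ∀ y, ut t y = ut t ξ + ∫ z in ξ..y, uxt t z := by
    intro y
    obtain ⟨M, hM⟩ := (isCompact_Icc.prod (isCompact_uIcc (a := ξ) (b := y))).exists_bound_of_continuousOn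
      (hcxt.mono (prod_mono_right (subset_univ _)))
    have h1 := (intervalIntegral.hasDerivAt_integral_of_dominated_loc_of_deriv_le
      (μ := volume) (F := ux) (F' := uxt) (x₀ := t) (a := ξ) (b := y) (s := Ioo 0 T)
      (bound := fun _ => M) (isOpen_Ioo.mem_nhds htT)
      (by
        filter_upwards [isOpen_Ioo.mem_nhds htT] with τ hτ
        exact (hsl hcx τ (Ioo_subset_Icc_self hτ)).aestronglyMeasurable)
      ((hsl hcx t htI).intervalIntegrable _ _)
      ((hsl hcxt t htI).aestronglyMeasurable)
      (ae_of_all _ fun z hz τ hτ => hM (τ, z) ⟨Ioo_subset_Icc_self hτ, uIoc_subset_uIcc hz⟩)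
      intervalIntegrable_const
      (ae_of_all _ fun z _ τ hτ => hxt τ (Ioo_subset_Icc_self hτ) z)).2
    have h2 : HasDerivAt (fun τ => ∫ z in ξ..y, ux τ z) (ut t y - ut t ξ) t := by
      refine ((ht t htI y).sub (ht t htI ξ)).congr_of_eventuallyEq ?_
      filter_upwards [isOpen_Ioo.mem_nhds htT] with τ hτ
      exact intervalIntegral.integral_eq_sub_of_hasDerivAt
        (fun z _ => hx τ (Ioo_subset_Icc_self hτ) z)
        ((hsl hcx τ (Ioo_subset_Icc_self hτ)).intervalIntegrable _ _)
    linarith [h1.unique h2]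
  have hc := hsl hcxt t htI
  have h3 : HasDerivAt (fun y => ut t ξ + ∫ z in ξ..y, uxt t z) (uxt t ξ) ξ :=
    (intervalIntegral.integral_hasDerivAt_right (hc.intervalIntegrable _ _)
      (hc.stronglyMeasurableAtFilter _ _) hc.continuousAt).const_add _
  exact h3.congr_of_eventuallyEq (Eventually.of_forall key)

/-- Integrated form of a local energy inequality `∂ₜ e + D ≤ ∂_ξ F` whose flux `F` vanishes at
spatial infinity. -/
lemma energy_inequality_of_flux {e et D F F' : ℝ → ℝ → ℝ} {T t : ℝ} (ht : t ∈ Icc 0 T)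
    (he : ContinuousOn (fun q : ℝ × ℝ => e q.1 q.2) (Icc 0 T ×ˢ univ))
    (het : ContinuousOn (fun q : ℝ × ℝ => et q.1 q.2) (Icc 0 T ×ˢ univ))
    (hD : ContinuousOn (fun q : ℝ × ℝ => D q.1 q.2) (Icc 0 T ×ˢ univ))
    (hderiv : ∀ τ ∈ Icc 0 T, ∀ ξ, HasDerivAt (fun τ => e τ ξ) (et τ ξ) τ)
    (hF : ∀ τ ∈ Ioo 0 T, ∀ ξ, HasDerivAt (F τ) (F' τ ξ) ξ)
    (hle : ∀ τ ∈ Ioo 0 T, ∀ ξ, et τ ξ + D τ ξ ≤ F' τ ξ)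
    (hdec : ∀ ε > 0, ∃ R : ℝ, ∀ τ ∈ Ioo 0 T, ∀ ξ : ℝ, R ≤ |ξ| → |F τ ξ| ≤ ε)
    (he0 : ∀ ξ, 0 ≤ e 0 ξ) (hD0 : ∀ τ ξ, 0 ≤ D τ ξ)
    (hei : ∀ τ ∈ Icc 0 T, Integrable (e τ)) (hDi : ∀ τ ∈ Icc 0 T, Integrable (D τ))
    (hDc : ContinuousOn (fun τ => ∫ ξ, D τ ξ) (Icc 0 T)) :
    (∫ ξ, e t ξ) + (∫ τ in (0 : ℝ)..t, ∫ ξ, D τ ξ) ≤ ∫ ξ, e 0 ξ := by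
  have hT : (0 : ℝ) ≤ T := ht.1.trans ht.2
  have h0T : (0 : ℝ) ∈ Icc 0 T := ⟨le_rfl, hT⟩
  have hsub : Icc 0 t ⊆ Icc 0 T := Icc_subset_Icc_right ht.2
  -- Clamping the time variable makes everything continuous on the whole plane.
  have hclamp : ∀ {h : ℝ → ℝ → ℝ}, ContinuousOn (fun q : ℝ × ℝ => h q.1 q.2) (Icc 0 T ×ˢ univ) →
      Continuous fun q : ℝ × ℝ => h (projIcc 0 T hT q.1) q.2 := fun hh =>
    hh.comp_continuous (f := fun q : ℝ × ℝ => ((projIcc 0 T hT q.1 : ℝ), q.2))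
      (by fun_prop) fun q => ⟨(projIcc 0 T hT q.1).2, mem_univ _⟩
  have hpr : ∀ τ ∈ Icc 0 T, (projIcc 0 T hT τ : ℝ) = τ := fun τ hτ => by
    rw [projIcc_of_mem hT hτ]
  have hsl : ∀ {h : ℝ → ℝ → ℝ}, ContinuousOn (fun q : ℝ × ℝ => h q.1 q.2) (Icc 0 T ×ˢ univ) →
      ∀ τ ∈ Icc 0 T, Continuous (h τ) := fun hh τ hτ =>
    hh.comp_continuous (f := fun z => (τ, z)) (by fun_prop) fun z => ⟨hτ, mem_univ _⟩
  have hslice : ∀ {h : ℝ → ℝ → ℝ}, ContinuousOn (fun q : ℝ × ℝ => h q.1 q.2) (Icc 0 T ×ˢ univ) →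
      ∀ R : ℝ, ContinuousOn (fun τ => ∫ ξ in (-R)..R, h τ ξ) (Icc 0 T) := by
    intro h hh R
    have := intervalIntegral.continuous_parametric_intervalIntegral_of_continuous'
      (f := fun τ ξ => h (projIcc 0 T hT τ) ξ) (μ := volume) (hclamp hh) (-R) R
    exact this.continuousOn.congr fun τ hτ => by simp only [hpr τ hτ]
  have hint : ∀ {k : ℝ → ℝ}, ContinuousOn k (Icc 0 T) → IntervalIntegrable k volume 0 t :=
    fun hk => (hk.mono (by rw [uIcc_of_le ht.1]; exact hsub)).intervalIntegrable
  have hbox : ∀ R : ℝ, (∫ ξ in (-R)..R, e t ξ) - (∫ ξ in (-R)..R, e 0 ξ)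
      = ∫ τ in (0 : ℝ)..t, ∫ ξ in (-R)..R, et τ ξ := by
    intro R
    have hc := hclamp het
    have hswap := MeasureTheory.intervalIntegral_intervalIntegral_swap (a := 0) (b := t)
      (c := -R) (d := R)
      (F := fun τ ξ => et (projIcc 0 T hT τ) ξ)
      (hc.continuousOn.integrableOn_compact (isCompact_uIcc.prod isCompact_uIcc) |>.mono_set
        (prod_mono uIoc_subset_uIcc uIoc_subset_uIcc))
    have h1 : (∫ τ in (0 : ℝ)..t, ∫ ξ in (-R)..R, et τ ξ)
        = ∫ τ in (0 : ℝ)..t, ∫ ξ in (-R)..R, et (projIcc 0 T hT τ) ξ := by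
      refine intervalIntegral.integral_congr fun τ hτ => ?_
      rw [uIcc_of_le ht.1] at hτ
      simp only [hpr τ (hsub hτ)]
    rw [h1, hswap, ← intervalIntegral.integral_sub
      ((hsl he t ht).intervalIntegrable _ _) ((hsl he 0 h0T).intervalIntegrable _ _)]
    refine intervalIntegral.integral_congr fun ξ _ => ?_
    refine (intervalIntegral.integral_eq_sub_of_hasDerivAt (f := fun τ => e τ ξ) ?_ ?_).symm
    · intro τ hτ
      rw [uIcc_of_le ht.1] at hτ
      simpa only [hpr τ (hsub hτ)] using hderiv τ (hsub hτ) ξ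
    · exact (hc.comp (f := fun τ => (τ, ξ)) (by fun_prop)).intervalIntegrable _ _
  have hmain : ∀ ε > 0, ∀ᶠ R : ℝ in atTop, (∫ ξ in (-R)..R, e t ξ)
      + (∫ τ in (0 : ℝ)..t, ∫ ξ in (-R)..R, D τ ξ) ≤ (∫ ξ, e 0 ξ) + t * (2 * ε) := by
    intro ε hε
    obtain ⟨R₀, hR₀⟩ := hdec ε hε
    filter_upwards [eventually_ge_atTop R₀, eventually_ge_atTop 0] with R hR hR0
    have hstrip : ∀ τ ∈ Ioo 0 t,
        (∫ ξ in (-R)..R, et τ ξ) + (∫ ξ in (-R)..R, D τ ξ) ≤ 2 * ε := by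
      intro τ hτ
      have hτT : τ ∈ Ioo 0 T := ⟨hτ.1, hτ.2.trans_le ht.2⟩
      have hτI : τ ∈ Icc 0 T := Ioo_subset_Icc_self hτT
      have hc := (hsl het τ hτI).add (hsl hD τ hτI)
      rw [← intervalIntegral.integral_add ((hsl het τ hτI).intervalIntegrable _ _)
        ((hsl hD τ hτI).intervalIntegrable _ _)]
      have := intervalIntegral.integral_le_sub_of_hasDeriv_right_of_le (a := -R) (b := R)
        (g := F τ) (g' := F' τ) (φ := fun ξ => et τ ξ + D τ ξ) (by linarith)
        (fun z _ => (hF τ hτT z).continuousAt.continuousWithinAt)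
        (fun z _ => (hF τ hτT z).hasDerivWithinAt) hc.continuousOn.integrableOn_Icc
        (fun z _ => hle τ hτT z)
      have h1 := hR₀ τ hτT R (by rwa [abs_of_nonneg hR0])
      have h2 := hR₀ τ hτT (-R) (by rwa [abs_neg, abs_of_nonneg hR0])
      rw [abs_le] at h1 h2
      linarith
    have h3 : (∫ τ in (0 : ℝ)..t, ((∫ ξ in (-R)..R, et τ ξ) + (∫ ξ in (-R)..R, D τ ξ)))
        ≤ ∫ _ in (0 : ℝ)..t, 2 * ε :=
      intervalIntegral.integral_mono_on_of_le_Ioo ht.1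
        ((hint (hslice het R)).add (hint (hslice hD R))) intervalIntegrable_const hstrip
    rw [intervalIntegral.integral_add (hint (hslice het R)) (hint (hslice hD R)), ← hbox R,
      intervalIntegral.integral_const, smul_eq_mul, sub_zero] at h3
    have h4 : (∫ ξ in (-R)..R, e 0 ξ) ≤ ∫ ξ, e 0 ξ := by
      rw [intervalIntegral.integral_of_le (by linarith)]
      exact setIntegral_le_integral (hei 0 h0T) (ae_of_all _ he0)
    linarith
  have hlim1 : Tendsto (fun R : ℝ => ∫ ξ in (-R)..R, e t ξ) atTop (𝓝 (∫ ξ, e t ξ)) :=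
    intervalIntegral_tendsto_integral (hei t ht) tendsto_neg_atTop_atBot tendsto_id
  have hlim2 : Tendsto (fun R : ℝ => ∫ τ in (0 : ℝ)..t, ∫ ξ in (-R)..R, D τ ξ) atTop
      (𝓝 (∫ τ in (0 : ℝ)..t, ∫ ξ, D τ ξ)) := by
    refine intervalIntegral.tendsto_integral_filter_of_dominated_convergence
      (fun τ => ∫ ξ, D τ ξ) (Eventually.of_forall fun R => (hint (hslice hD R)).aestronglyMeasurable_restrict_uIoc)
      ?_ (hint hDc) ?_
    · filter_upwards [eventually_ge_atTop 0] with R hR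
      refine ae_of_all _ fun τ hτ => ?_
      rw [uIoc_of_le ht.1] at hτ
      have hτT := hsub (Ioc_subset_Icc_self hτ)
      rw [intervalIntegral.integral_of_le (by linarith : -R ≤ R), Real.norm_eq_abs,
        abs_of_nonneg (integral_nonneg fun ξ => hD0 τ ξ)]
      exact setIntegral_le_integral (hDi τ hτT) (ae_of_all _ (hD0 τ))
    · refine ae_of_all _ fun τ hτ => ?_
      rw [uIoc_of_le ht.1] at hτ
      exact intervalIntegral_tendsto_integral (hDi τ (hsub (Ioc_subset_Icc_self hτ)))
        tendsto_neg_atTop_atBot tendsto_id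
  have hfin : ∀ ε > 0, (∫ ξ, e t ξ) + (∫ τ in (0 : ℝ)..t, ∫ ξ, D τ ξ)
      ≤ (∫ ξ, e 0 ξ) + t * (2 * ε) := fun ε hε =>
    le_of_tendsto (hlim1.add hlim2) (hmain ε hε)
  have hlim3 : Tendsto (fun ε : ℝ => (∫ ξ, e 0 ξ) + t * (2 * ε)) (𝓝[>] 0) (𝓝 (∫ ξ, e 0 ξ)) := by
    have : Continuous fun ε : ℝ => (∫ ξ, e 0 ξ) + t * (2 * ε) := by fun_prop
    simpa using (this.tendsto 0).mono_left nhdsWithin_le_nhds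
  exact ge_of_tendsto hlim3 (by filter_upwards [self_mem_nhdsWithin] with ε hε using hfin ε hε)

/-- Pointwise coercivity of the dissipation against the linear cross terms and the nonlinear
remainders. Here `a, b, c` stand for `Φ, Φ_ξ, Φ_ξξ`, and `x, y` for `Ψ, Ψ_ξ`. -/
lemma dissipation_le {r B σ K δ a b c x y m n κ w N π π' : ℝ}
    (hr : 0 < r) (hB : 1 ≤ B) (hσ : r ≤ σ) (hm : r ≤ m) (hn : |n| ≤ B)
    (hκ : 0 ≤ κ) (hκB : κ ≤ B) (hw : 0 ≤ w) (hwB : w ≤ B)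
    (hN : |N| ≤ B * (|b| * |c| + b ^ 2)) (hπ : |π| ≤ B * b ^ 2)
    (hπ' : |π'| ≤ B * (|b| * |c| + b ^ 2))
    (ha : |a| ≤ δ) (hb : |b| ≤ δ) (hx : |x| ≤ δ) (hy : |y| ≤ δ)
    (hK : K = 1 + B / r ^ 2 + B ^ 2 / r ^ 2)
    (hδ : δ * (2 * B + 2 * B ^ 2 + 2 * K * B + K * B ^ 2) ≤ r / 4) :
    -m * c ^ 2 - n * b * c - c * N - σ * κ * w ^ 2 * y ^ 2 / 2 + w * κ * b * y - w * y * π'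
      + K * (-m * b ^ 2 + a * N - w * x * π) ≤ -(r / 4) * (b ^ 2 + c ^ 2) := by
  have hσ0 : 0 < σ := hr.trans_le hσ
  have hB0 : 0 ≤ B := by linarith
  have hδ0 : 0 ≤ δ := (abs_nonneg a).trans ha
  have hK0 : 0 ≤ K := by rw [hK]; positivity
  have hKr : K * r = r + B / r + B ^ 2 / r := by rw [hK]; field_simp
  have hbc : |b| * |c| ≤ b ^ 2 + c ^ 2 := by
    nlinarith [sq_nonneg (|b| - |c|), sq_abs b, sq_abs c, sq_nonneg b, sq_nonneg c]
  set X := b ^ 2 + c ^ 2 with hX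
  have hX0 : 0 ≤ X := by positivity
  have hbX : b ^ 2 ≤ X := le_add_of_nonneg_right (sq_nonneg c)
  have hcX : c ^ 2 ≤ X := le_add_of_nonneg_left (sq_nonneg b)
  have e1 : -(n * b * c) ≤ r / 2 * c ^ 2 + B ^ 2 / (2 * r) * b ^ 2 := by
    have h1 : -(n * b * c) ≤ B * (|b| * |c|) := by
      refine (neg_le_abs _).trans ?_
      rw [abs_mul, abs_mul, mul_assoc]
      exact mul_le_mul_of_nonneg_right hn (by positivity)
    have h2 : r / 2 * c ^ 2 + B ^ 2 / (2 * r) * b ^ 2 - B * (|b| * |c|)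
        = (r * |c| - B * |b|) ^ 2 / (2 * r) := by
      rw [← sq_abs b, ← sq_abs c]; field_simp; ring
    have h3 : 0 ≤ (r * |c| - B * |b|) ^ 2 / (2 * r) := by positivity
    linarith
  have e2 : w * κ * b * y ≤ σ * κ * w ^ 2 * y ^ 2 / 2 + B / (2 * r) * b ^ 2 := by
    have h2 : σ * κ * w ^ 2 * y ^ 2 / 2 + κ / (2 * σ) * b ^ 2 - w * κ * b * y
        = κ / (2 * σ) * (σ * w * y - b) ^ 2 := by field_simp; ring
    have h3 : 0 ≤ κ / (2 * σ) * (σ * w * y - b) ^ 2 := by positivity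
    have h4 : κ / (2 * σ) ≤ B / (2 * r) := by gcongr
    have h5 := mul_le_mul_of_nonneg_right h4 (sq_nonneg b)
    linarith
  have e3 : -(c * N) ≤ δ * (2 * B) * X := by
    refine (neg_le_abs _).trans ?_
    rw [abs_mul]
    calc |c| * |N| ≤ |c| * (B * (|b| * |c| + b ^ 2)) := by gcongr
      _ = |b| * (B * (c ^ 2 + |b| * |c|)) := by rw [← sq_abs b, ← sq_abs c]; ring
      _ ≤ δ * (B * (X + X)) := by gcongr
      _ = _ := by ring
  have e4 : -(w * y * π') ≤ δ * (2 * B ^ 2) * X := by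
    refine (neg_le_abs _).trans ?_
    rw [abs_mul, abs_mul, abs_of_nonneg hw]
    calc w * |y| * |π'| ≤ B * δ * (B * (X + X)) := by
          gcongr
          exact hπ'.trans (by gcongr)
      _ = _ := by ring
  have e5 : a * N ≤ δ * (2 * B) * X := by
    refine (le_abs_self _).trans ?_
    rw [abs_mul]
    calc |a| * |N| ≤ δ * (B * (X + X)) := by
          gcongr
          exact hN.trans (by gcongr)
      _ = _ := by ring
  have e6 : -(w * x * π) ≤ δ * B ^ 2 * X := by
    refine (neg_le_abs _).trans ?_
    rw [abs_mul, abs_mul, abs_of_nonneg hw]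
    calc w * |x| * |π| ≤ B * δ * (B * X) := by
          gcongr
          exact hπ.trans (by gcongr)
      _ = _ := by ring
  have e7 : -m * c ^ 2 ≤ -r * c ^ 2 :=
    mul_le_mul_of_nonneg_right (neg_le_neg hm) (sq_nonneg c)
  have e7' : -m * b ^ 2 ≤ -r * b ^ 2 :=
    mul_le_mul_of_nonneg_right (neg_le_neg hm) (sq_nonneg b)
  have e8 : K * (-m * b ^ 2 + a * N - w * x * π)
      ≤ -(K * r) * b ^ 2 + δ * (2 * K * B + K * B ^ 2) * X := by
    have : K * (-m * b ^ 2 + a * N - w * x * π)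
        ≤ K * (-r * b ^ 2 + δ * (2 * B) * X + δ * B ^ 2 * X) := by
      apply mul_le_mul_of_nonneg_left _ hK0
      linarith
    linarith
  have e9 : δ * (2 * B + 2 * B ^ 2 + 2 * K * B + K * B ^ 2) * X ≤ r / 4 * X := by gcongr
  have e10 : B / (2 * r) * b ^ 2 ≤ B / r * b ^ 2 := by gcongr; linarith
  have e11 : B ^ 2 / (2 * r) * b ^ 2 ≤ B ^ 2 / r * b ^ 2 := by gcongr; linarith
  rw [hKr] at e8
  have e12 : r / 2 * X ≤ r * b ^ 2 + r / 2 * c ^ 2 := by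
    have : 0 ≤ r * b ^ 2 := by positivity
    rw [hX]; linarith
  linarith

/-- The energy flux is controlled by the size of the perturbation. -/
lemma abs_flux_le {B K η s a b x y w m ft : ℝ} (hB : 1 ≤ B) (hK : 0 ≤ K) (hη : η ≤ 1)
    (hs : |s| ≤ B) (hw : |w| ≤ B) (hm : |m| ≤ B) (hft : |ft| ≤ 7 * B)
    (ha : |a| ≤ η) (hb : |b| ≤ η) (hx : |x| ≤ η) (hy : |y| ≤ η) :
    |K * (s * a ^ 2 / 2 + a * x + a * (m * b) + s * (w * x ^ 2) / 2) + b * ft - s * b ^ 2 / 2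
      + s * (w * y ^ 2) / 2| ≤ (4 * K + 9) * B ^ 2 * η := by
  have hη0 : 0 ≤ η := (abs_nonneg a).trans ha
  have hB0 : 0 ≤ B := by linarith
  have hBB : B ≤ B ^ 2 := by nlinarith
  have hprod : ∀ {u v : ℝ}, |u| ≤ η → |v| ≤ η → |u * v| ≤ η := fun {u v} hu hv => by
    rw [abs_mul]
    calc |u| * |v| ≤ η * 1 := by gcongr; exact hv.trans hη
      _ = η := mul_one _
  have h1 : |s * a ^ 2| ≤ B ^ 2 * η := by
    rw [abs_mul, sq a]; exact mul_le_mul (hs.trans hBB) (hprod ha ha) (abs_nonneg _) (by positivity)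
  have h2 : |a * x| ≤ B ^ 2 * η := (hprod ha hx).trans (by nlinarith)
  have h3 : |a * (m * b)| ≤ B ^ 2 * η := by
    rw [mul_left_comm, abs_mul]
    exact mul_le_mul (hm.trans hBB) (hprod ha hb) (abs_nonneg _) (by positivity)
  have h4 : ∀ {u : ℝ}, |u| ≤ η → |s * (w * u ^ 2)| ≤ B ^ 2 * η := fun {u} hu => by
    rw [← mul_assoc, abs_mul, abs_mul, sq u, sq B]
    exact mul_le_mul (mul_le_mul hs hw (abs_nonneg _) hB0) (hprod hu hu) (abs_nonneg _)
      (by positivity)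
  have h5 : |b * ft| ≤ 7 * B ^ 2 * η := by
    rw [abs_mul]
    calc |b| * |ft| ≤ η * (7 * B) := by gcongr
      _ ≤ 7 * B ^ 2 * η := by nlinarith
  have h6 : |s * b ^ 2| ≤ B ^ 2 * η := by
    rw [abs_mul, sq b]; exact mul_le_mul (hs.trans hBB) (hprod hb hb) (abs_nonneg _) (by positivity)
  have h7 := h4 hx
  have h8 := h4 hy
  have h0 : 0 ≤ B ^ 2 * η := by positivity
  have hin : |s * a ^ 2 / 2 + a * x + a * (m * b) + s * (w * x ^ 2) / 2| ≤ 4 * (B ^ 2 * η) := by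
    rw [abs_le] at *; constructor <;> linarith [h1.1, h1.2, h2.1, h2.2, h3.1, h3.2, h7.1, h7.2]
  have hin' : |K * (s * a ^ 2 / 2 + a * x + a * (m * b) + s * (w * x ^ 2) / 2)|
      ≤ K * (4 * (B ^ 2 * η)) := by
    rw [abs_mul, abs_of_nonneg hK]; gcongr
  rw [abs_le] at *
  constructor <;> linarith [hin'.1, hin'.2, h5.1, h5.2, h6.1, h6.2, h8.1, h8.2]

/-- Uniform bounds for the coefficients of the system along the profile, and Taylor bounds for
perturbations of size at most `ρ`. -/
structure CoeffBounds (p g tv : ℝ → ℝ) (s r B ρ : ℝ) : Prop where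
  r_pos : 0 < r
  one_le : 1 ≤ B
  s_le : s ≤ -r
  abs_s_le : |s| ≤ B
  le_weight : ∀ ξ, r ≤ -(deriv p (tv ξ))⁻¹
  weight_le : ∀ ξ, -(deriv p (tv ξ))⁻¹ ≤ B
  le_visc : ∀ ξ, r ≤ deriv g (tv ξ)
  visc_le : ∀ ξ, deriv g (tv ξ) ≤ B
  visc_deriv : ∀ ξ, |deriv (deriv g) (tv ξ) * deriv tv ξ| ≤ B
  press_deriv : ∀ ξ, |deriv (deriv p) (tv ξ) * deriv tv ξ| ≤ B
  prel_le : ∀ ξ b, |b| ≤ ρ → |p (tv ξ + b) - p (tv ξ) - deriv p (tv ξ) * b| ≤ B * b ^ 2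
  dprel_le : ∀ ξ b c, |b| ≤ ρ →
    |(deriv p (tv ξ + b) - deriv p (tv ξ)) * c +
      (deriv p (tv ξ + b) - deriv p (tv ξ) - deriv (deriv p) (tv ξ) * b) * deriv tv ξ|
      ≤ B * (|b| * |c| + b ^ 2)
  gterm_le : ∀ ξ b c, |b| ≤ ρ →
    |(deriv g (tv ξ + b) - deriv g (tv ξ)) * c +
      (deriv g (tv ξ + b) - deriv g (tv ξ) - deriv (deriv g) (tv ξ) * b) * deriv tv ξ|
      ≤ B * (|b| * |c| + b ^ 2)

lemma exists_coeffBounds {p g tv : ℝ → ℝ} {s vp vm : ℝ}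
    (hp : ContDiffOn ℝ (⊤ : ℕ∞) p (Ioi 0)) (hpd : ∀ v ∈ Ioi (0 : ℝ), deriv p v < 0)
    (hg : ContDiffOn ℝ (⊤ : ℕ∞) (deriv g) (Ioi 0)) (hgpos : ∀ v ∈ Ioi (0 : ℝ), 0 < deriv g v)
    (hvp : 0 < vp) (hs : s < 0) (htv : ∀ ξ, tv ξ ∈ Ioo vp vm)
    (hbdd : ∃ M : ℝ, ∀ ξ, |deriv tv ξ| ≤ M) :
    ∃ r B : ℝ, CoeffBounds p g tv s r B (vp / 2) := by
  obtain ⟨M, hM⟩ := hbdd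
  have hp1 : ContDiffOn ℝ (⊤ : ℕ∞) (deriv p) (Ioi 0) := hp.deriv_of_isOpen isOpen_Ioi (by simp)
  have hp2 : ContDiffOn ℝ (⊤ : ℕ∞) (deriv (deriv p)) (Ioi 0) :=
    hp1.deriv_of_isOpen isOpen_Ioi (by simp)
  have hg2 : ContDiffOn ℝ (⊤ : ℕ∞) (deriv (deriv g)) (Ioi 0) :=
    hg.deriv_of_isOpen isOpen_Ioi (by simp)
  have hsub : Icc vp vm ⊆ Ioi (0 : ℝ) := fun x hx => hvp.trans_le hx.1
  have hmem : ∀ ξ, tv ξ ∈ Icc vp vm := fun ξ => Ioo_subset_Icc_self (htv ξ)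
  have hne : (Icc vp vm).Nonempty := ⟨_, hmem 0⟩
  have hw : ContinuousOn (fun v => -(deriv p v)⁻¹) (Icc vp vm) :=
    ((hp1.continuousOn.mono hsub).inv₀ fun v hv => (hpd v (hsub hv)).ne).neg
  have hlow : ∀ {k : ℝ → ℝ}, ContinuousOn k (Icc vp vm) → (∀ v ∈ Icc vp vm, 0 < k v) →
      ∃ r > 0, ∀ ξ, r ≤ k (tv ξ) := fun {k} hk hpos => by
    obtain ⟨v, hv, hmin⟩ := isCompact_Icc.exists_isMinOn hne hk
    exact ⟨k v, hpos v hv, fun ξ => hmin (hmem ξ)⟩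
  have hup : ∀ {k : ℝ → ℝ}, ContinuousOn k (Icc vp vm) → ∃ C, ∀ ξ, |k (tv ξ)| ≤ C :=
    fun {k} hk => by
    obtain ⟨C, hC⟩ := isCompact_Icc.exists_bound_of_continuousOn hk
    exact ⟨C, fun ξ => hC _ (hmem ξ)⟩
  obtain ⟨r₁, hr₁, hw₁⟩ := hlow hw fun v hv => by
    have := inv_lt_zero.2 (hpd v (hsub hv)); linarith
  obtain ⟨r₂, hr₂, hm₁⟩ := hlow (hg.continuousOn.mono hsub) fun v hv => hgpos v (hsub hv)
  obtain ⟨C₁, hC₁⟩ := hup hw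
  obtain ⟨C₂, hC₂⟩ := hup (hg.continuousOn.mono hsub)
  obtain ⟨C₃, hC₃⟩ := hup (hg2.continuousOn.mono hsub)
  obtain ⟨C₄, hC₄⟩ := hup (hp2.continuousOn.mono hsub)
  have hρ : 0 < vp / 2 := by positivity
  obtain ⟨L₁, hL₁⟩ := exists_taylor_bound hp (b := vm + vp / 2) hρ
  obtain ⟨L₂, hL₂⟩ := exists_taylor_bound hp1 (b := vm + vp / 2) hρ
  obtain ⟨L₃, hL₃⟩ := exists_taylor_bound hg (b := vm + vp / 2) hρ
  have hI : ∀ ξ, tv ξ ∈ Icc (vp / 2) (vm + vp / 2) := fun ξ =>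
    ⟨by linarith [(htv ξ).1], by linarith [(htv ξ).2]⟩
  have hIb : ∀ ξ b, |b| ≤ vp / 2 → tv ξ + b ∈ Icc (vp / 2) (vm + vp / 2) := fun ξ b hb => by
    rw [abs_le] at hb
    exact ⟨by linarith [(htv ξ).1, hb.1], by linarith [(htv ξ).2, hb.2]⟩
  have hrem : ∀ {k : ℝ → ℝ} {L : ℝ}, (∀ x ∈ Icc (vp / 2) (vm + vp / 2),
      ∀ y ∈ Icc (vp / 2) (vm + vp / 2), |k y - k x| ≤ L * |y - x| ∧
        |k y - k x - deriv k x * (y - x)| ≤ L * (y - x) ^ 2) → ∀ ξ b c, |b| ≤ vp / 2 →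
      |(k (tv ξ + b) - k (tv ξ)) * c + (k (tv ξ + b) - k (tv ξ) - deriv k (tv ξ) * b) * deriv tv ξ|
        ≤ (|L| + |L| * |M|) * (|b| * |c| + b ^ 2) := by
    intro k L hk ξ b c hb
    obtain ⟨h1, h2⟩ := hk _ (hI ξ) _ (hIb ξ b hb)
    rw [add_sub_cancel_left] at h1 h2
    have hM' : |deriv tv ξ| ≤ |M| := (hM ξ).trans (le_abs_self M)
    calc _ ≤ |k (tv ξ + b) - k (tv ξ)| * |c|
          + |k (tv ξ + b) - k (tv ξ) - deriv k (tv ξ) * b| * |deriv tv ξ| := by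
          rw [← abs_mul, ← abs_mul]; exact abs_add_le _ _
      _ ≤ |L| * |b| * |c| + |L| * b ^ 2 * |M| := by
          gcongr
          · exact h1.trans (by gcongr; exact le_abs_self L)
          · exact h2.trans (by gcongr; exact le_abs_self L)
      _ ≤ _ := by
          have : 0 ≤ |L| * |M| * (|b| * |c|) := by positivity
          have : 0 ≤ |L| * b ^ 2 := by positivity
          nlinarith
  set B := 1 + |s| + |C₁| + |C₂| + |C₃| * |M| + |C₄| * |M| + |L₁| + (|L₂| + |L₂| * |M|)
    + (|L₃| + |L₃| * |M|) with hBdef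
  have hB : 1 ≤ B ∧ |s| ≤ B ∧ |C₁| ≤ B ∧ |C₂| ≤ B ∧ |C₃| * |M| ≤ B ∧ |C₄| * |M| ≤ B ∧ |L₁| ≤ B ∧
      |L₂| + |L₂| * |M| ≤ B ∧ |L₃| + |L₃| * |M| ≤ B := by
    have h1 := abs_nonneg s
    have h2 := abs_nonneg C₁
    have h3 := abs_nonneg C₂
    have h4 : 0 ≤ |C₃| * |M| := by positivity
    have h5 : 0 ≤ |C₄| * |M| := by positivity
    have h6 := abs_nonneg L₁
    have h7 : 0 ≤ |L₂| + |L₂| * |M| := by positivity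
    have h8 : 0 ≤ |L₃| + |L₃| * |M| := by positivity
    refine ⟨?_, ?_, ?_, ?_, ?_, ?_, ?_, ?_, ?_⟩ <;> linarith
  clear_value B
  obtain ⟨b0, b1, b2, b3, b4, b5, b6, b7, b8⟩ := hB
  refine ⟨min (-s) (min r₁ r₂), B, ?_⟩
  exact
  { r_pos := by simp [hs, hr₁, hr₂]
    one_le := b0
    s_le := by have := min_le_left (-s) (min r₁ r₂); linarith
    abs_s_le := b1
    le_weight := fun ξ => ((min_le_right _ _).trans (min_le_left _ _)).trans (hw₁ ξ)
    weight_le := fun ξ => (le_abs_self _).trans ((hC₁ ξ).trans ((le_abs_self _).trans b2))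
    le_visc := fun ξ => ((min_le_right _ _).trans (min_le_right _ _)).trans (hm₁ ξ)
    visc_le := fun ξ => (le_abs_self _).trans ((hC₂ ξ).trans ((le_abs_self _).trans b3))
    visc_deriv := fun ξ => by
      rw [abs_mul]
      exact (mul_le_mul ((hC₃ ξ).trans (le_abs_self _)) ((hM ξ).trans (le_abs_self _))
        (abs_nonneg _) (abs_nonneg _)).trans b4
    press_deriv := fun ξ => by
      rw [abs_mul]
      exact (mul_le_mul ((hC₄ ξ).trans (le_abs_self _)) ((hM ξ).trans (le_abs_self _))
        (abs_nonneg _) (abs_nonneg _)).trans b5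
    prel_le := fun ξ b hb => by
      have h := (hL₁ _ (hI ξ) _ (hIb ξ b hb)).2
      rw [add_sub_cancel_left] at h
      exact h.trans (mul_le_mul_of_nonneg_right ((le_abs_self _).trans b6) (sq_nonneg b))
    dprel_le := fun ξ b c hb => (hrem hL₂ ξ b c hb).trans
      (mul_le_mul_of_nonneg_right b7 (by positivity))
    gterm_le := fun ξ b c hb => (hrem hL₃ ξ b c hb).trans
      (mul_le_mul_of_nonneg_right b8 (by positivity)) }

/-- The weight `1 / (-p'(ṽ))` that symmetrizes the system. -/
def symWeight (p tv : ℝ → ℝ) (ξ : ℝ) : ℝ := -(deriv p (tv ξ))⁻¹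

/-- The energy density: `K` times the zeroth-order energy plus the first-order energy. -/
def energyDensity (K : ℝ) (p tv φ ψ : ℝ → ℝ) (ξ : ℝ) : ℝ :=
  K * (φ ξ ^ 2 + symWeight p tv ξ * ψ ξ ^ 2) / 2
    + (deriv φ ξ ^ 2 + symWeight p tv ξ * deriv ψ ξ ^ 2) / 2

/-- The time derivative of the energy density. -/
def energyRate (K : ℝ) (p tv : ℝ → ℝ) (Φ Ψ : ℝ → ℝ → ℝ) (t ξ : ℝ) : ℝ :=
  K * (Φ t ξ * deriv (fun τ => Φ τ ξ) t + symWeight p tv ξ * (Ψ t ξ * deriv (fun τ => Ψ τ ξ) t))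
    + (deriv (Φ t) ξ * deriv (fun τ => deriv (Φ τ) ξ) t
      + symWeight p tv ξ * (deriv (Ψ t) ξ * deriv (fun τ => deriv (Ψ τ) ξ) t))

/-- The spatial flux of the energy. -/
def energyFlux (K s : ℝ) (p g tv : ℝ → ℝ) (Φ Ψ : ℝ → ℝ → ℝ) (t ξ : ℝ) : ℝ :=
  K * (s * Φ t ξ ^ 2 / 2 + Φ t ξ * Ψ t ξ + Φ t ξ * (deriv g (tv ξ) * deriv (Φ t) ξ)
      + s * (symWeight p tv ξ * Ψ t ξ ^ 2) / 2)
    + deriv (Φ t) ξ * deriv (fun τ => Φ τ ξ) t - s * deriv (Φ t) ξ ^ 2 / 2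
    + s * (symWeight p tv ξ * deriv (Ψ t) ξ ^ 2) / 2

lemma hasDerivAt_of_contDiffOn_Ioi {f : ℝ → ℝ} (hf : ContDiffOn ℝ (⊤ : ℕ∞) f (Ioi 0)) {v : ℝ}
    (hv : 0 < v) : HasDerivAt f (deriv f v) v :=
  ((hf.contDiffAt (isOpen_Ioi.mem_nhds hv)).differentiableAt (by simp)).hasDerivAt

lemma hasDerivAt_iteratedDeriv_of_contDiff {f : ℝ → ℝ} (hf : ContDiff ℝ 4 f) {j : ℕ} (hj : j ≤ 3)
    (ξ : ℝ) : HasDerivAt (iteratedDeriv j f) (iteratedDeriv (j + 1) f ξ) ξ := by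
  rw [iteratedDeriv_succ]
  exact (hf.differentiable_iteratedDeriv j (by exact_mod_cast Nat.lt_succ_of_le hj) ξ).hasDerivAt

lemma hasDerivAt_symWeight {p tv : ℝ → ℝ} (hp : ContDiffOn ℝ (⊤ : ℕ∞) p (Ioi 0))
    (hpd : ∀ v ∈ Ioi (0 : ℝ), deriv p v < 0) (htv : ContDiff ℝ (⊤ : ℕ∞) tv)
    (htvpos : ∀ ξ, 0 < tv ξ) (ξ : ℝ) :
    HasDerivAt (symWeight p tv)
      (deriv (deriv p) (tv ξ) * deriv tv ξ * symWeight p tv ξ ^ 2) ξ := by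
  have hp1 : ContDiffOn ℝ (⊤ : ℕ∞) (deriv p) (Ioi 0) := hp.deriv_of_isOpen isOpen_Ioi (by simp)
  have h : HasDerivAt (fun z => deriv p (tv z)) _ ξ :=
    (hasDerivAt_of_contDiffOn_Ioi hp1 (htvpos ξ)).comp ξ
      (htv.differentiable (by simp) ξ).hasDerivAt
  have hne := (hpd _ (htvpos ξ)).ne
  refine (h.fun_inv hne).fun_neg.congr_deriv ?_
  simp only [symWeight]
  field_simp

lemma IsClassicalSolution.exists_hasDerivAt_energyFlux {p g tv : ℝ → ℝ} {s T r B ρ K δ : ℝ}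
    {Φ Ψ : ℝ → ℝ → ℝ} (hsol : IsClassicalSolution p g tv s T Φ Ψ)
    (hc : CoeffBounds p g tv s r B ρ)
    (hp : ContDiffOn ℝ (⊤ : ℕ∞) p (Ioi 0)) (hpd : ∀ v ∈ Ioi (0 : ℝ), deriv p v < 0)
    (hpdd : ∀ v ∈ Ioi (0 : ℝ), 0 ≤ deriv (deriv p) v)
    (hg : ContDiffOn ℝ (⊤ : ℕ∞) (deriv g) (Ioi 0))
    (htv : ContDiff ℝ (⊤ : ℕ∞) tv) (htvρ : ∀ ξ, ρ < tv ξ) (htvd : ∀ ξ, deriv tv ξ < 0)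
    (hK : K = 1 + B / r ^ 2 + B ^ 2 / r ^ 2) (hδρ : δ ≤ ρ)
    (hδ : δ * (2 * B + 2 * B ^ 2 + 2 * K * B + K * B ^ 2) ≤ r / 4)
    {t : ℝ} (ht : t ∈ Ioo 0 T) (hΦ : ∀ ξ, |Φ t ξ| ≤ δ) (hΦ' : ∀ ξ, |deriv (Φ t) ξ| ≤ δ)
    (hΨ : ∀ ξ, |Ψ t ξ| ≤ δ) (hΨ' : ∀ ξ, |deriv (Ψ t) ξ| ≤ δ) (ξ : ℝ) :
    ∃ F', HasDerivAt (energyFlux K s p g tv Φ Ψ t) F' ξ ∧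
      energyRate K p tv Φ Ψ t ξ + r / 4 * (deriv (Φ t) ξ ^ 2 + iteratedDeriv 2 (Φ t) ξ ^ 2)
        ≤ F' := by
  have htI : t ∈ Icc 0 T := Ioo_subset_Icc_self ht
  have hδ0 : 0 ≤ δ := (abs_nonneg _).trans (hΦ 0)
  have htvpos : ∀ ξ, 0 < tv ξ := fun ξ => (hδ0.trans hδρ).trans_lt (htvρ ξ)
  have hp1 : ContDiffOn ℝ (⊤ : ℕ∞) (deriv p) (Ioi 0) := hp.deriv_of_isOpen isOpen_Ioi (by simp)
  have hxΦ : ∀ τ ∈ Icc 0 T, ∀ z, HasDerivAt (Φ τ) (deriv (Φ τ) z) z := fun τ hτ z => by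
    simpa using hasDerivAt_iteratedDeriv_of_contDiff (hsol.regΦ τ hτ) (j := 0) (by norm_num) z
  have hxΨ : ∀ τ ∈ Icc 0 T, ∀ z, HasDerivAt (Ψ τ) (deriv (Ψ τ) z) z := fun τ hτ z => by
    simpa using hasDerivAt_iteratedDeriv_of_contDiff (hsol.regΨ τ hτ) (j := 0) (by norm_num) z
  have hxxΦ : ∀ z, HasDerivAt (deriv (Φ t)) (iteratedDeriv 2 (Φ t) z) z := fun z => by
    simpa using hasDerivAt_iteratedDeriv_of_contDiff (hsol.regΦ t htI) (j := 1) (by norm_num) z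
  have hxxΨ : ∀ z, HasDerivAt (deriv (Ψ t)) (iteratedDeriv 2 (Ψ t) z) z := fun z => by
    simpa using hasDerivAt_iteratedDeriv_of_contDiff (hsol.regΨ t htI) (j := 1) (by norm_num) z
  have hmixΦ := hasDerivAt_time_deriv (ut := fun τ z => deriv (fun r => Φ r z) τ)
    (uxt := fun τ z => deriv (fun r => deriv (Φ r) z) τ) hxΦ
    (fun τ hτ z => by simpa using (hsol.tdiffΦ 0 (by norm_num) τ hτ z).hasDerivAt)
    (fun τ hτ z => by simpa using (hsol.tdiffΦ 1 (by norm_num) τ hτ z).hasDerivAt)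
    (by simpa using hsol.spContΦ 1 (by norm_num))
    (by simpa using hsol.mixContΦ 1 (by norm_num)) ht ξ
  have hmixΨ := hasDerivAt_time_deriv (ut := fun τ z => deriv (fun r => Ψ r z) τ)
    (uxt := fun τ z => deriv (fun r => deriv (Ψ r) z) τ) hxΨ
    (fun τ hτ z => by simpa using (hsol.tdiffΨ 0 (by norm_num) τ hτ z).hasDerivAt)
    (fun τ hτ z => by simpa using (hsol.tdiffΨ 1 (by norm_num) τ hτ z).hasDerivAt)
    (by simpa using hsol.spContΨ 1 (by norm_num))
    (by simpa using hsol.mixContΨ 1 (by norm_num)) ht ξ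
  have htv1 : HasDerivAt tv (deriv tv ξ) ξ := (htv.differentiable (by simp) ξ).hasDerivAt
  have hw := hasDerivAt_symWeight hp hpd htv htvpos ξ
  have hm : HasDerivAt (fun z => deriv g (tv z)) (deriv (deriv g) (tv ξ) * deriv tv ξ) ξ :=
    (hasDerivAt_of_contDiffOn_Ioi hg (htvpos ξ)).comp ξ htv1
  have hpt : HasDerivAt (fun z => p (tv z)) (deriv p (tv ξ) * deriv tv ξ) ξ :=
    (hasDerivAt_of_contDiffOn_Ioi hp (htvpos ξ)).comp ξ htv1
  have hQ : HasDerivAt (fun z => deriv p (tv z)) (deriv (deriv p) (tv ξ) * deriv tv ξ) ξ :=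
    (hasDerivAt_of_contDiffOn_Ioi hp1 (htvpos ξ)).comp ξ htv1
  have hvpos : 0 < tv ξ + deriv (Φ t) ξ := by
    have h1 := hΦ' ξ
    rw [abs_le] at h1
    linarith [htvρ ξ]
  have hpv : HasDerivAt (fun z => p (tv z + deriv (Φ t) z))
      (deriv p (tv ξ + deriv (Φ t) ξ) * (deriv tv ξ + iteratedDeriv 2 (Φ t) ξ)) ξ :=
    (hasDerivAt_of_contDiffOn_Ioi hp hvpos).comp ξ (htv1.fun_add (hxxΦ ξ))
  have hΨt : ∀ z, deriv (fun τ => Ψ τ z) t = s * deriv (Ψ t) z - deriv p (tv z) * deriv (Φ t) z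
      - (p (tv z + deriv (Φ t) z) - p (tv z) - deriv p (tv z) * deriv (Φ t) z) := fun z => by
    have := hsol.eq2 t htI z
    simp only [prel] at this
    linarith
  have hmixΨ' := (((hxxΨ ξ).const_mul s).fun_sub (hQ.fun_mul (hxxΦ ξ))).fun_sub
    ((hpv.fun_sub hpt).fun_sub (hQ.fun_mul (hxxΦ ξ)))
  have hΨxt := hmixΨ.unique (hmixΨ'.congr_of_eventuallyEq (Eventually.of_forall hΨt))
  have hΦt := hsol.eq1 t htI ξ
  have hΨtξ := hΨt ξ
  have hflux := ((((((((hxΦ t htI ξ).fun_pow 2).const_mul s).div_const 2).fun_add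
    ((hxΦ t htI ξ).fun_mul (hxΨ t htI ξ))).fun_add
    ((hxΦ t htI ξ).fun_mul (hm.fun_mul (hxxΦ ξ)))).fun_add
    (((hw.fun_mul ((hxΨ t htI ξ).fun_pow 2)).const_mul s).div_const 2)).const_mul K).fun_add
    ((hxxΦ ξ).fun_mul hmixΦ) |>.fun_sub ((((hxxΦ ξ).fun_pow 2).const_mul s).div_const 2) |>.fun_add
    (((hw.fun_mul ((hxxΨ ξ).fun_pow 2)).const_mul s).div_const 2)
  refine ⟨_, hflux, ?_⟩
  have hdiss := dissipation_le (a := Φ t ξ) (b := deriv (Φ t) ξ) (c := iteratedDeriv 2 (Φ t) ξ)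
    (x := Ψ t ξ) (y := deriv (Ψ t) ξ) (m := deriv g (tv ξ)) (σ := -s)
    (n := deriv (deriv g) (tv ξ) * deriv tv ξ) (w := symWeight p tv ξ)
    (κ := -(deriv (deriv p) (tv ξ) * deriv tv ξ)) (N := Gterm g tv (Φ t) ξ)
    hc.r_pos hc.one_le (by linarith [hc.s_le]) (hc.le_visc ξ) (hc.visc_deriv ξ)
    (neg_nonneg.2 (mul_nonpos_of_nonneg_of_nonpos (hpdd _ (htvpos ξ)) (htvd ξ).le))
    ((neg_le_abs _).trans (hc.press_deriv ξ)) (hc.r_pos.le.trans (hc.le_weight ξ))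
    (hc.weight_le ξ) (hc.gterm_le ξ _ _ ((hΦ' ξ).trans hδρ))
    (hc.prel_le ξ _ ((hΦ' ξ).trans hδρ))
    (hc.dprel_le ξ _ (iteratedDeriv 2 (Φ t) ξ) ((hΦ' ξ).trans hδρ))
    (hΦ ξ) (hΦ' ξ) (hΨ ξ) (hΨ' ξ) hK hδ
  have hwQ : symWeight p tv ξ * deriv p (tv ξ) = -1 := by
    have := (hpd _ (htvpos ξ)).ne
    simp only [symWeight]
    field_simp
  simp only [energyRate]
  rw [hΨxt, hΨtξ]
  have hΦt' : deriv (fun τ => Φ τ ξ) t = s * deriv (Φ t) ξ + deriv (Ψ t) ξ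
      + deriv g (tv ξ) * iteratedDeriv 2 (Φ t) ξ
      + deriv (deriv g) (tv ξ) * deriv tv ξ * deriv (Φ t) ξ + Gterm g tv (Φ t) ξ := by linarith
  rw [hΦt']
  have hκ : 0 ≤ K * (-s * (-(deriv (deriv p) (tv ξ) * deriv tv ξ)) * symWeight p tv ξ ^ 2
      * Ψ t ξ ^ 2 / 2) := by
    have h1 : 0 ≤ -(deriv (deriv p) (tv ξ) * deriv tv ξ) :=
      neg_nonneg.2 (mul_nonpos_of_nonneg_of_nonpos (hpdd _ (htvpos ξ)) (htvd ξ).le)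
    have h2 : 0 ≤ -s := by linarith [hc.s_le, hc.r_pos]
    have h3 : 0 ≤ K := by
      have := hc.r_pos
      have := hc.one_le
      rw [hK]; positivity
    positivity
  have hzero : (symWeight p tv ξ * deriv p (tv ξ) + 1) * (K * (Ψ t ξ * deriv (Φ t) ξ)
      + deriv (Ψ t) ξ * iteratedDeriv 2 (Φ t) ξ) = 0 := by rw [hwQ]; ring
  generalize Gterm g tv (Φ t) ξ = N at *
  generalize deriv (fun τ => deriv (Φ τ) ξ) t = bt at *
  generalize p (tv ξ + deriv (Φ t) ξ) = pv at *
  generalize deriv p (tv ξ + deriv (Φ t) ξ) = dpv at *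
  linarith

lemma L2sq_nonneg (w : ℝ → ℝ) : 0 ≤ L2sq w := integral_nonneg fun _ => sq_nonneg _

lemma HkSq_nonneg (k : ℕ) (w : ℝ → ℝ) : 0 ≤ HkSq k w :=
  Finset.sum_nonneg fun _ _ => L2sq_nonneg _

lemma HkSq_one (w : ℝ → ℝ) : HkSq 1 w = L2sq w + L2sq (deriv w) := by
  simp [HkSq, Finset.sum_range_succ]

lemma HkSq_one_deriv (w : ℝ → ℝ) :
    HkSq 1 (deriv w) = L2sq (deriv w) + L2sq (iteratedDeriv 2 w) := by
  rw [HkSq_one, iteratedDeriv_succ, iteratedDeriv_one]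

lemma sq_iteratedDeriv_le_HkSq {f : ℝ → ℝ} (hf : ContDiff ℝ 4 f)
    (hi : ∀ j ≤ 4, Integrable fun ξ => iteratedDeriv j f ξ ^ 2)
    (hdec : ∀ j ≤ 3, ∀ ε > 0, ∃ R : ℝ, ∀ ξ, R ≤ |ξ| → |iteratedDeriv j f ξ| < ε)
    {j : ℕ} (hj : j ≤ 1) (ξ : ℝ) : iteratedDeriv j f ξ ^ 2 ≤ HkSq 3 f := by
  have hlim : Tendsto (iteratedDeriv j f) atBot (𝓝 0) := by
    rw [Metric.tendsto_nhds]
    intro ε hε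
    obtain ⟨R, hR⟩ := hdec j (by lia) ε hε
    filter_upwards [tendsto_abs_atBot_atTop.eventually_ge_atTop R] with z hz
    simpa using hR z hz
  have h := sq_le_integral_sq_add_integral_deriv_sq
    (hasDerivAt_iteratedDeriv_of_contDiff hf (j := j) (by lia))
    (hf.continuous_iteratedDeriv (j + 1) (by exact_mod_cast (by lia : j + 1 ≤ 4)))
    (hi j (by lia)) (hi (j + 1) (by lia)) hlim ξ
  refine h.trans ?_
  have h0 := L2sq_nonneg (iteratedDeriv 0 f)
  have h1 := L2sq_nonneg (iteratedDeriv 1 f)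
  have h2 := L2sq_nonneg (iteratedDeriv 2 f)
  have h3 := L2sq_nonneg (iteratedDeriv 3 f)
  simp only [HkSq, Finset.sum_range_succ, Finset.sum_range_zero]
  simp only [L2sq] at *
  interval_cases j <;> linarith

lemma IsClassicalSolution.abs_le_of_sqrt_le {p g tv : ℝ → ℝ} {s T δ : ℝ} {Φ Ψ : ℝ → ℝ → ℝ}
    (hsol : IsClassicalSolution p g tv s T Φ Ψ) {t : ℝ} (ht : t ∈ Icc 0 T)
    (hδ : Real.sqrt (pairHkSq 3 (Φ t) (Ψ t)) ≤ δ) :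
    (∀ ξ, |Φ t ξ| ≤ δ) ∧ (∀ ξ, |deriv (Φ t) ξ| ≤ δ) ∧ (∀ ξ, |Ψ t ξ| ≤ δ) ∧
      ∀ ξ, |deriv (Ψ t) ξ| ≤ δ := by
  have hΦ : ∀ j ≤ 1, ∀ ξ, |iteratedDeriv j (Φ t) ξ| ≤ δ := fun j hj ξ => by
    refine (Real.abs_le_sqrt ?_).trans hδ
    refine (sq_iteratedDeriv_le_HkSq (hsol.regΦ t ht) (fun j hj => hsol.sqIntΦ j hj t ht)
      (fun j hj ε hε => ?_) hj ξ).trans (le_add_of_nonneg_right (HkSq_nonneg _ _))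
    obtain ⟨R, hR⟩ := hsol.decayΦ j hj ε hε
    exact ⟨R, hR t ht⟩
  have hΨ : ∀ j ≤ 1, ∀ ξ, |iteratedDeriv j (Ψ t) ξ| ≤ δ := fun j hj ξ => by
    refine (Real.abs_le_sqrt ?_).trans hδ
    refine (sq_iteratedDeriv_le_HkSq (hsol.regΨ t ht) (fun j hj => hsol.sqIntΨ j hj t ht)
      (fun j hj ε hε => ?_) hj ξ).trans (le_add_of_nonneg_left (HkSq_nonneg _ _))
    obtain ⟨R, hR⟩ := hsol.decayΨ j hj ε hε
    exact ⟨R, hR t ht⟩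
  exact ⟨by simpa using hΦ 0 (by norm_num), by simpa using hΦ 1 le_rfl,
    by simpa using hΨ 0 (by norm_num), by simpa using hΨ 1 le_rfl⟩

/-- The energy flux vanishes at spatial infinity, uniformly in time. -/
lemma IsClassicalSolution.energyFlux_decay {p g tv : ℝ → ℝ} {s T r B ρ K : ℝ}
    {Φ Ψ : ℝ → ℝ → ℝ} (hsol : IsClassicalSolution p g tv s T Φ Ψ)
    (hc : CoeffBounds p g tv s r B ρ) (hK : 0 ≤ K)
    (hρ : ∀ t ∈ Icc 0 T, ∀ ξ, |deriv (Φ t) ξ| ≤ ρ) :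
    ∀ ε > 0, ∃ R : ℝ, ∀ t ∈ Ioo 0 T, ∀ ξ : ℝ, R ≤ |ξ| → |energyFlux K s p g tv Φ Ψ t ξ| ≤ ε := by
  intro ε hε
  have hB := hc.one_le
  have hC : 0 < (4 * K + 9) * B ^ 2 := by positivity
  set η := min 1 (ε / ((4 * K + 9) * B ^ 2)) with hηdef
  have hη : 0 < η := lt_min one_pos (div_pos hε hC)
  have hη1 : η ≤ 1 := min_le_left _ _
  have hηε : (4 * K + 9) * B ^ 2 * η ≤ ε := by
    rw [mul_comm, ← le_div_iff₀ hC]; exact min_le_right _ _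
  obtain ⟨R₀, h₀⟩ := hsol.decayΦ 0 (by norm_num) η hη
  obtain ⟨R₁, h₁⟩ := hsol.decayΦ 1 (by norm_num) η hη
  obtain ⟨R₂, h₂⟩ := hsol.decayΦ 2 (by norm_num) η hη
  obtain ⟨R₃, h₃⟩ := hsol.decayΨ 0 (by norm_num) η hη
  obtain ⟨R₄, h₄⟩ := hsol.decayΨ 1 (by norm_num) η hη
  simp only [iteratedDeriv_zero, iteratedDeriv_one] at h₀ h₁ h₃ h₄
  refine ⟨max (max (max R₀ R₁) (max R₂ R₃)) R₄, fun t ht ξ hξ => ?_⟩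
  simp only [max_le_iff] at hξ
  obtain ⟨⟨⟨hξ0, hξ1⟩, hξ2, hξ3⟩, hξ4⟩ := hξ
  have htI : t ∈ Icc 0 T := Ioo_subset_Icc_self ht
  have a0 := (h₀ t htI ξ hξ0).le
  have a1 := (h₁ t htI ξ hξ1).le
  have a2 := (h₂ t htI ξ hξ2).le
  have a3 := (h₃ t htI ξ hξ3).le
  have a4 := (h₄ t htI ξ hξ4).le
  have hr := hc.r_pos
  have hm : |deriv g (tv ξ)| ≤ B := by
    rw [abs_of_pos (hr.trans_le (hc.le_visc ξ))]; exact hc.visc_le ξ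
  have hw : |symWeight p tv ξ| ≤ B := by
    rw [symWeight, abs_of_pos (hr.trans_le (hc.le_weight ξ))]; exact hc.weight_le ξ
  have hB0 : 0 ≤ B := by linarith
  have hft : |deriv (fun τ => Φ τ ξ) t| ≤ 7 * B := by
    have hG : |Gterm g tv (Φ t) ξ| ≤ B * (1 * 1 + 1) :=
      (hc.gterm_le ξ _ (iteratedDeriv 2 (Φ t) ξ) (hρ t htI ξ)).trans (by
        rw [← sq_abs (deriv (Φ t) ξ), sq]
        gcongr
        · exact a1.trans hη1
        · exact a2.trans hη1
        · exact mul_le_one₀ (a1.trans hη1) (abs_nonneg _) (a1.trans hη1))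
    have h1 : |s * deriv (Φ t) ξ| ≤ B * 1 := by
      rw [abs_mul]; exact mul_le_mul hc.abs_s_le (a1.trans hη1) (abs_nonneg _) hB0
    have h2 : |deriv g (tv ξ) * iteratedDeriv 2 (Φ t) ξ| ≤ B * 1 := by
      rw [abs_mul]; exact mul_le_mul hm (a2.trans hη1) (abs_nonneg _) hB0
    have h3 : |deriv (deriv g) (tv ξ) * deriv tv ξ * deriv (Φ t) ξ| ≤ B * 1 := by
      rw [abs_mul]; exact mul_le_mul (hc.visc_deriv ξ) (a1.trans hη1) (abs_nonneg _) hB0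
    have h4 := hsol.eq1 t htI ξ
    have h5 := a4.trans hη1
    rw [abs_le] at *
    constructor <;> linarith [h1.1, h1.2, h2.1, h2.2, h3.1, h3.2, h5.1, h5.2, hG.1, hG.2]
  exact (abs_flux_le hB hK hη1 hc.abs_s_le hw hm hft a0 a1 a3 a4).trans hηε

lemma IsClassicalSolution.energy_estimate {p g tv : ℝ → ℝ} {s T r B ρ K δ : ℝ}
    {Φ Ψ : ℝ → ℝ → ℝ} (hsol : IsClassicalSolution p g tv s T Φ Ψ)
    (hc : CoeffBounds p g tv s r B ρ)
    (hp : ContDiffOn ℝ (⊤ : ℕ∞) p (Ioi 0)) (hpd : ∀ v ∈ Ioi (0 : ℝ), deriv p v < 0)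
    (hpdd : ∀ v ∈ Ioi (0 : ℝ), 0 ≤ deriv (deriv p) v)
    (hg : ContDiffOn ℝ (⊤ : ℕ∞) (deriv g) (Ioi 0))
    (htv : ContDiff ℝ (⊤ : ℕ∞) tv) (htvρ : ∀ ξ, ρ < tv ξ) (htvd : ∀ ξ, deriv tv ξ < 0)
    (hK : K = 1 + B / r ^ 2 + B ^ 2 / r ^ 2) (hδρ : δ ≤ ρ)
    (hδ : δ * (2 * B + 2 * B ^ 2 + 2 * K * B + K * B ^ 2) ≤ r / 4)
    (hsmall : ∀ t ∈ Icc 0 T, Real.sqrt (pairHkSq 3 (Φ t) (Ψ t)) ≤ δ)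
    {t : ℝ} (ht : t ∈ Icc 0 T) :
    min 1 r / 2 * pairHkSq 1 (Φ t) (Ψ t) + r / 4 * (∫ τ in (0 : ℝ)..t, HkSq 1 (deriv (Φ τ)))
      ≤ K * B / 2 * pairHkSq 1 (Φ 0) (Ψ 0) := by
  have hr := hc.r_pos
  have hB := hc.one_le
  have h0T : (0 : ℝ) ∈ Icc 0 T := ⟨le_rfl, ht.1.trans ht.2⟩
  have hδ0 : 0 ≤ δ := (Real.sqrt_nonneg _).trans (hsmall t ht)
  have htvpos : ∀ ξ, 0 < tv ξ := fun ξ => (hδ0.trans hδρ).trans_lt (htvρ ξ)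
  have hK1 : 1 ≤ K := by
    have h1 : 0 ≤ B / r ^ 2 := by positivity
    have h2 : 0 ≤ B ^ 2 / r ^ 2 := by positivity
    linarith
  have hwc : Continuous (symWeight p tv) := continuous_iff_continuousAt.2 fun ξ =>
    (hasDerivAt_symWeight hp hpd htv htvpos ξ).continuousAt
  have hwc2 : Continuous fun q : ℝ × ℝ => symWeight p tv q.2 := hwc.comp continuous_snd
  have hΦ0 := hsol.spContΦ 0 (by norm_num)
  have hΦ1 := hsol.spContΦ 1 (by norm_num)
  have hΦ2 := hsol.spContΦ 2 (by norm_num)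
  have hΨ0 := hsol.spContΨ 0 (by norm_num)
  have hΨ1 := hsol.spContΨ 1 (by norm_num)
  have hΦt0 := hsol.mixContΦ 0 (by norm_num)
  have hΦt1 := hsol.mixContΦ 1 (by norm_num)
  have hΨt0 := hsol.mixContΨ 0 (by norm_num)
  have hΨt1 := hsol.mixContΨ 1 (by norm_num)
  have dΦ0 := hsol.tdiffΦ 0 (by norm_num)
  have dΦ1 := hsol.tdiffΦ 1 (by norm_num)
  have dΨ0 := hsol.tdiffΨ 0 (by norm_num)
  have dΨ1 := hsol.tdiffΨ 1 (by norm_num)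
  have iΦ0 := hsol.sqIntΦ 0 (by norm_num)
  have iΦ1 := hsol.sqIntΦ 1 (by norm_num)
  have iΦ2 := hsol.sqIntΦ 2 (by norm_num)
  have iΨ0 := hsol.sqIntΨ 0 (by norm_num)
  have iΨ1 := hsol.sqIntΨ 1 (by norm_num)
  have lΦ1 := hsol.l2ContΦ 1 (by norm_num)
  have lΦ2 := hsol.l2ContΦ 2 (by norm_num)
  simp only [iteratedDeriv_zero, iteratedDeriv_one] at hΦ0 hΦ1 hΨ0 hΨ1 hΦt0 hΦt1 hΨt0 hΨt1
  simp only [iteratedDeriv_zero, iteratedDeriv_one] at dΦ0 dΦ1 dΨ0 dΨ1 iΦ0 iΦ1 iΨ0 iΨ1 lΦ1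
  have hec : ContinuousOn (fun q : ℝ × ℝ => energyDensity K p tv (Φ q.1) (Ψ q.1) q.2)
      (Icc 0 T ×ˢ univ) := by
    unfold energyDensity
    fun_prop
  -- The energy density is equivalent to the sum of squares.
  set S : ℝ → ℝ → ℝ := fun τ ξ =>
    (Φ τ ξ ^ 2 + deriv (Φ τ) ξ ^ 2) + (Ψ τ ξ ^ 2 + deriv (Ψ τ) ξ ^ 2) with hSdef
  have hSi : ∀ τ ∈ Icc 0 T, Integrable (S τ) := fun τ hτ =>
    ((iΦ0 τ hτ).add (iΦ1 τ hτ)).add ((iΨ0 τ hτ).add (iΨ1 τ hτ))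
  have hSint : ∀ τ ∈ Icc 0 T, ∫ ξ, S τ ξ = pairHkSq 1 (Φ τ) (Ψ τ) := fun τ hτ => by
    rw [pairHkSq, HkSq_one, HkSq_one]
    simp only [L2sq, hSdef]
    rw [← integral_add (iΦ0 τ hτ) (iΦ1 τ hτ), ← integral_add (iΨ0 τ hτ) (iΨ1 τ hτ)]
    exact integral_add ((iΦ0 τ hτ).add (iΦ1 τ hτ)) ((iΨ0 τ hτ).add (iΨ1 τ hτ))
  have hlow : ∀ τ ξ, min 1 r / 2 * S τ ξ ≤ energyDensity K p tv (Φ τ) (Ψ τ) ξ := fun τ ξ => by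
    have hwr : min 1 r ≤ symWeight p tv ξ := (min_le_right _ _).trans (hc.le_weight ξ)
    have h1 : min 1 r ≤ 1 := min_le_left _ _
    have hw0 : 0 ≤ symWeight p tv ξ := hr.le.trans (hc.le_weight ξ)
    have e1 := mul_le_mul_of_nonneg_right h1 (sq_nonneg (Φ τ ξ))
    have e2 := mul_le_mul_of_nonneg_right h1 (sq_nonneg (deriv (Φ τ) ξ))
    have e3 := mul_le_mul_of_nonneg_right hwr (sq_nonneg (Ψ τ ξ))
    have e4 := mul_le_mul_of_nonneg_right hwr (sq_nonneg (deriv (Ψ τ) ξ))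
    have e5 : 1 * (Φ τ ξ ^ 2 + symWeight p tv ξ * Ψ τ ξ ^ 2)
        ≤ K * (Φ τ ξ ^ 2 + symWeight p tv ξ * Ψ τ ξ ^ 2) := by gcongr
    simp only [hSdef, energyDensity]
    linarith
  have hupp : ∀ τ ξ, energyDensity K p tv (Φ τ) (Ψ τ) ξ ≤ K * B / 2 * S τ ξ := fun τ ξ => by
    have hwB : symWeight p tv ξ ≤ B := hc.weight_le ξ
    have e1 := mul_le_mul_of_nonneg_right hB (sq_nonneg (Φ τ ξ))
    have e2 := mul_le_mul_of_nonneg_right hB (sq_nonneg (deriv (Φ τ) ξ))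
    have e3 := mul_le_mul_of_nonneg_right hwB (sq_nonneg (Ψ τ ξ))
    have e4 := mul_le_mul_of_nonneg_right hwB (sq_nonneg (deriv (Ψ τ) ξ))
    have e5 : K * (Φ τ ξ ^ 2 + symWeight p tv ξ * Ψ τ ξ ^ 2)
        ≤ K * (B * Φ τ ξ ^ 2 + B * Ψ τ ξ ^ 2) := by gcongr; linarith
    have e6 : 1 * (B * deriv (Φ τ) ξ ^ 2 + B * deriv (Ψ τ) ξ ^ 2)
        ≤ K * (B * deriv (Φ τ) ξ ^ 2 + B * deriv (Ψ τ) ξ ^ 2) := by gcongr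
    simp only [hSdef, energyDensity]
    linarith
  have hS0 : ∀ τ ξ, 0 ≤ S τ ξ := fun τ ξ => by simp only [hSdef]; positivity
  have he0 : ∀ τ ξ, 0 ≤ energyDensity K p tv (Φ τ) (Ψ τ) ξ := fun τ ξ =>
    (mul_nonneg (by positivity) (hS0 τ ξ)).trans (hlow τ ξ)
  have hei : ∀ τ ∈ Icc 0 T, Integrable (energyDensity K p tv (Φ τ) (Ψ τ)) := fun τ hτ => by
    refine ((hSi τ hτ).const_mul (K * B / 2)).mono' ?_ (ae_of_all _ fun ξ => ?_)
    · exact (hec.comp_continuous (f := fun z => (τ, z)) (by fun_prop)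
        fun z => ⟨hτ, mem_univ _⟩).aestronglyMeasurable
    · rw [Real.norm_eq_abs, abs_of_nonneg (he0 τ ξ)]
      exact hupp τ ξ
  have hDint : ∀ τ ∈ Icc 0 T,
      ∫ ξ, r / 4 * (deriv (Φ τ) ξ ^ 2 + iteratedDeriv 2 (Φ τ) ξ ^ 2)
        = r / 4 * HkSq 1 (deriv (Φ τ)) := fun τ hτ => by
    rw [integral_const_mul, integral_add (iΦ1 τ hτ) (iΦ2 τ hτ), HkSq_one_deriv]
    rfl
  have hmain := energy_inequality_of_flux ht
    (e := fun τ => energyDensity K p tv (Φ τ) (Ψ τ))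
    (et := energyRate K p tv Φ Ψ)
    (D := fun τ ξ => r / 4 * (deriv (Φ τ) ξ ^ 2 + iteratedDeriv 2 (Φ τ) ξ ^ 2))
    (F := energyFlux K s p g tv Φ Ψ)
    (F' := fun τ ξ => deriv (energyFlux K s p g tv Φ Ψ τ) ξ)
    hec (by unfold energyRate; fun_prop) (by fun_prop)
    (fun τ hτ ξ => by
      have hΦd := (dΦ0 τ hτ ξ).hasDerivAt.fun_pow 2
      have hΨd := (dΨ0 τ hτ ξ).hasDerivAt.fun_pow 2
      have hΦd1 := (dΦ1 τ hτ ξ).hasDerivAt.fun_pow 2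
      have hΨd1 := (dΨ1 τ hτ ξ).hasDerivAt.fun_pow 2
      refine ((((hΦd.fun_add (hΨd.const_mul (symWeight p tv ξ))).const_mul K).div_const 2).fun_add
        ((hΦd1.fun_add (hΨd1.const_mul (symWeight p tv ξ))).div_const 2)).congr_deriv ?_
      simp only [energyRate]
      ring)
    (fun τ hτ ξ => by
      obtain ⟨h1, h2, h3, h4⟩ := hsol.abs_le_of_sqrt_le (Ioo_subset_Icc_self hτ)
        (hsmall τ (Ioo_subset_Icc_self hτ))
      obtain ⟨F', hF', -⟩ := hsol.exists_hasDerivAt_energyFlux hc hp hpd hpdd hg htv htvρ htvd hK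
        hδρ hδ hτ h1 h2 h3 h4 ξ
      exact hF'.differentiableAt.hasDerivAt)
    (fun τ hτ ξ => by
      obtain ⟨h1, h2, h3, h4⟩ := hsol.abs_le_of_sqrt_le (Ioo_subset_Icc_self hτ)
        (hsmall τ (Ioo_subset_Icc_self hτ))
      obtain ⟨F', hF', hle⟩ := hsol.exists_hasDerivAt_energyFlux hc hp hpd hpdd hg htv htvρ htvd hK
        hδρ hδ hτ h1 h2 h3 h4 ξ
      rw [hF'.deriv]
      exact hle)
    (hsol.energyFlux_decay hc (by linarith) fun τ hτ ξ =>
      ((hsol.abs_le_of_sqrt_le hτ (hsmall τ hτ)).2.1 ξ).trans hδρ)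
    (he0 0) (fun τ ξ => by positivity) hei
    (fun τ hτ => ((iΦ1 τ hτ).add (iΦ2 τ hτ)).const_mul (r / 4))
    (((lΦ1.add lΦ2).const_mul (r / 4)).congr fun τ hτ => by
      simp only [hDint τ hτ, HkSq_one_deriv, Pi.add_apply])
  have h1 : min 1 r / 2 * pairHkSq 1 (Φ t) (Ψ t) ≤ ∫ ξ, energyDensity K p tv (Φ t) (Ψ t) ξ := by
    rw [← hSint t ht, ← integral_const_mul]
    exact integral_mono ((hSi t ht).const_mul _) (hei t ht) (hlow t)
  have h2 : (∫ ξ, energyDensity K p tv (Φ 0) (Ψ 0) ξ) ≤ K * B / 2 * pairHkSq 1 (Φ 0) (Ψ 0) := by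
    rw [← hSint 0 h0T, ← integral_const_mul]
    exact integral_mono (hei 0 h0T) ((hSi 0 h0T).const_mul _) (hupp 0)
  have h3 : (∫ τ in (0 : ℝ)..t, ∫ ξ, r / 4 * (deriv (Φ τ) ξ ^ 2 + iteratedDeriv 2 (Φ τ) ξ ^ 2))
      = r / 4 * ∫ τ in (0 : ℝ)..t, HkSq 1 (deriv (Φ τ)) := by
    rw [← intervalIntegral.integral_const_mul]
    refine intervalIntegral.integral_congr fun τ hτ => ?_
    rw [uIcc_of_le ht.1] at hτ
    exact hDint τ ⟨hτ.1, hτ.2.trans ht.2⟩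
  rw [h3] at hmain
  linarith

theorem first_order_energy_estimate
    (p : ℝ → ℝ)
    (hp_smooth : ContDiffOn ℝ (⊤ : ℕ∞) p (Set.Ioi 0))
    (hpd : ∀ v ∈ Set.Ioi (0:ℝ), deriv p v < 0)
    (hpdd : ∀ v ∈ Set.Ioi (0:ℝ), 0 ≤ deriv (deriv p) v)
    (hpdd_ne : ∀ a b : ℝ, 0 < a → a < b → ∃ v ∈ Set.Ioo a b, deriv (deriv p) v ≠ 0)
    (μ : ℝ → ℝ)
    (hmu_smooth : ContDiffOn ℝ (⊤ : ℕ∞) μ (Set.Ioi 0))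
    (hmu_pos : ∀ v ∈ Set.Ioi (0:ℝ), 0 < μ v)
    (vp vm s : ℝ)
    (hvp : 0 < vp) (hvpvm : vp < vm)
    (hs : s = -Real.sqrt (-((p vp - p vm) / (vp - vm))))
    (hsneg : s < 0)
    (g : ℝ → ℝ)
    (hg : ∀ z ∈ Set.Ioi (0:ℝ), HasDerivAt g (μ z / z) z)
    (tv : ℝ → ℝ)
    (htv_smooth : ContDiff ℝ (⊤ : ℕ∞) tv)
    (htv_ode : ∀ ξ : ℝ, deriv tv ξ
        = tv ξ / (-s * μ (tv ξ)) * (s ^ 2 * (tv ξ - vm) + p (tv ξ) - p vm))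
    (htv_mem : ∀ ξ : ℝ, tv ξ ∈ Set.Ioo vp vm)
    (htv_dec : ∀ ξ : ℝ, deriv tv ξ < 0)
    (htv_bot : Filter.Tendsto tv Filter.atBot (nhds vm))
    (htv_top : Filter.Tendsto tv Filter.atTop (nhds vp))
    (htv_bdd : ∀ k : ℕ, ∃ M : ℝ, ∀ ξ : ℝ, |iteratedDeriv k tv ξ| ≤ M)
 :
    ∃ δ₀ > (0:ℝ), ∃ C > (0:ℝ), ∀ T > (0:ℝ), ∀ δ ≤ δ₀, ∀ Φ Ψ : ℝ → ℝ → ℝ,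
      IsClassicalSolution p g tv s T Φ Ψ →
      (∀ t ∈ Set.Icc (0:ℝ) T, Real.sqrt (pairHkSq 3 (Φ t) (Ψ t)) ≤ δ) →
      ∀ t ∈ Set.Icc (0:ℝ) T,
        pairHkSq 1 (Φ t) (Ψ t) + (∫ τ in (0:ℝ)..t, HkSq 1 (deriv (Φ τ)))
          ≤ C * pairHkSq 1 (Φ 0) (Ψ 0) := by
  have hgpos : ∀ v ∈ Ioi (0 : ℝ), 0 < deriv g v := fun v hv => by
    rw [(hg v hv).deriv]; exact div_pos (hmu_pos v hv) hv
  have hg1 : ContDiffOn ℝ (⊤ : ℕ∞) (deriv g) (Ioi 0) :=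
    (hmu_smooth.div contDiffOn_id fun v hv => (ne_of_gt hv)).congr fun v hv => (hg v hv).deriv
  obtain ⟨M, hM⟩ := htv_bdd 1
  obtain ⟨r, B, hc⟩ := exists_coeffBounds hp_smooth hpd hg1 hgpos hvp hsneg htv_mem
    ⟨M, by simpa using hM⟩
  have hr := hc.r_pos
  have hB := hc.one_le
  set K := 1 + B / r ^ 2 + B ^ 2 / r ^ 2 with hK
  have hK0 : 0 < K := by positivity
  set A := 2 * B + 2 * B ^ 2 + 2 * K * B + K * B ^ 2 with hA
  have hA0 : 0 < A := by positivity
  set c := min (min 1 r / 2) (r / 4) with hcdef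
  have hc0 : 0 < c := by positivity
  refine ⟨min (vp / 2) (r / 4 / A), by positivity, K * B / 2 / c, by positivity, ?_⟩
  intro T _ δ hδ Φ Ψ hsol hsmall t ht
  have hest := hsol.energy_estimate hc hp_smooth hpd hpdd hg1 htv_smooth
    (fun ξ => by linarith [(htv_mem ξ).1]) htv_dec hK (min_le_left _ _)
    (by rw [← hA, ← le_div_iff₀ hA0]; exact min_le_right _ _)
    (fun τ hτ => (hsmall τ hτ).trans hδ) ht
  have h1 : 0 ≤ pairHkSq 1 (Φ t) (Ψ t) := add_nonneg (HkSq_nonneg _ _) (HkSq_nonneg _ _)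
  have h2 : 0 ≤ ∫ τ in (0 : ℝ)..t, HkSq 1 (deriv (Φ τ)) :=
    intervalIntegral.integral_nonneg ht.1 fun τ _ => HkSq_nonneg _ _
  rw [div_mul_eq_mul_div, le_div_iff₀ hc0, mul_comm, mul_add]
  exact (add_le_add (mul_le_mul_of_nonneg_right (min_le_left _ _) h1)
    (mul_le_mul_of_nonneg_right (min_le_right _ _) h2)).trans hest
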